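/- arXiv:2601.12737 — 2 statements merged into one kernel-verified Lean document; each statement's English description precedes it below -/
import Mathlib

section
/- Let (σ_n)_{n≥1} be a strictly increasing sequence of positive integers with σ_{n+1} − σ_n ≥ n for all n ≥ 1 and such that (σ_{n+1} − σ_n)/n converges to a finite limit β ≥ 1 as n → ∞. Then the Hausdorff dimension of G((σ_n)) is at most (β−1)/(2β). -/
open Filter MeasureTheory Set
open scoped ENNReal NNReal Topology

/-- The Gauss map `T(x) = 1/x - ⌊1/x⌋`. -/
noncomputable def gaussMap (x : ℝ) : ℝ := 1 / x - ⌊1 / x⌋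

/-- The `n`-th partial quotient `a_n(x) = ⌊1 / T^{n-1} x⌋` of the regular continued
fraction expansion of `x` (meaningful for `n ≥ 1` and `x` irrational in `(0,1)`). -/
noncomputable def pq (x : ℝ) (n : ℕ) : ℕ := (⌊1 / (gaussMap^[n - 1] x)⌋).toNat

/-- The set `J` of irrationals in `(0,1)` with strictly increasing partial quotients. -/
def Jset : Set ℝ :=
  {x | x ∈ Set.Ioo (0 : ℝ) 1 ∧ Irrational x ∧ ∀ n : ℕ, 1 ≤ n → pq x n < pq x (n + 1)}

/-- The finite sequence `b start, b (start+1), …, b (start+len-1)` is an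
arithmetic progression. -/
def IsAPAt (b : ℕ → ℕ) (start len : ℕ) : Prop :=
  ∃ d : ℤ, ∀ i : ℕ, i + 2 ≤ len → (b (start + i + 1) : ℤ) - (b (start + i) : ℤ) = d

/-- The `F`-set: points of `J` such that for infinitely many `n ≥ 1` the partial
quotients `a_n(x), …, a_{n+ν_n-1}(x)` form an arithmetic progression. -/
def Fset (ν : ℕ → ℕ) : Set ℝ :=
  {x | x ∈ Jset ∧ ∀ N : ℕ, ∃ n : ℕ, N ≤ n ∧ 1 ≤ n ∧ IsAPAt (pq x) n (ν n)}

/-- The `G`-set: points of `J` such that for all sufficiently large `n` the partial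
quotients `a_{σ_n}(x), …, a_{σ_n+n-1}(x)` form an arithmetic progression. -/
def Gset (σ : ℕ → ℕ) : Set ℝ :=
  {x | x ∈ Jset ∧ ∃ N : ℕ, ∀ n : ℕ, N ≤ n → IsAPAt (pq x) (σ n) n}

theorem irrational_gaussMap {x : ℝ} (hx : Irrational x) : Irrational (gaussMap x) := by
  unfold gaussMap
  rw [one_div]
  exact hx.inv.sub_intCast _

theorem gaussMap_mem_Ioo {x : ℝ} (hx : Irrational x) : gaussMap x ∈ Ioo (0 : ℝ) 1 :=
  ⟨lt_of_le_of_ne (Int.fract_nonneg _) fun h => (irrational_gaussMap hx).ne_zero h.symm,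
    Int.fract_lt_one _⟩

theorem one_le_pq_one {x : ℝ} (hx : x ∈ Ioo (0 : ℝ) 1) : 1 ≤ pq x 1 := by
  have h : (1 : ℤ) ≤ ⌊1 / x⌋ := by
    rw [Int.le_floor, Int.cast_one, le_div_iff₀ hx.1]
    linarith [hx.2]
  simp only [pq, Nat.sub_self, Function.iterate_zero, id]
  omega

theorem one_div_eq_pq_add_gaussMap {x : ℝ} (hx : x ∈ Ioo (0 : ℝ) 1) :
    1 / x = pq x 1 + gaussMap x := by
  have h : (0 : ℤ) ≤ ⌊1 / x⌋ := Int.floor_nonneg.2 (one_div_pos.2 hx.1).le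
  have h' : ((pq x 1 : ℤ)) = ⌊1 / x⌋ := by
    simp only [pq, Nat.sub_self, Function.iterate_zero, id]
    exact Int.toNat_of_nonneg h
  have h'' : ((pq x 1 : ℝ)) = (⌊1 / x⌋ : ℝ) := by exact_mod_cast congrArg (Int.cast (R := ℝ)) h'
  rw [h'', gaussMap]
  ring

theorem pq_gaussMap (x : ℝ) (k : ℕ) : pq (gaussMap x) (k + 1) = pq x (k + 1 + 1) := by
  simp only [pq, Nat.add_sub_cancel, Function.iterate_succ_apply]

/-- Two points sharing their first `m` partial quotients are within `∏ a_k⁻²`. -/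
theorem abs_sub_le_prod_pq (m : ℕ) : ∀ {x y : ℝ}, x ∈ Ioo (0 : ℝ) 1 → Irrational x →
    y ∈ Ioo (0 : ℝ) 1 → Irrational y → (∀ k < m, pq x (k + 1) = pq y (k + 1)) →
    |x - y| ≤ ∏ k ∈ Finset.range m, ((pq x (k + 1) : ℝ) ^ 2)⁻¹ := by
  induction m with
  | zero =>
    intro x y hx _ hy _ _
    simp only [Finset.range_zero, Finset.prod_empty]
    rw [abs_le]
    constructor <;> linarith [hx.1, hx.2, hy.1, hy.2]
  | succ m ih =>
    intro x y hx hxi hy hyi h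
    have hT := ih (gaussMap_mem_Ioo hxi) (irrational_gaussMap hxi) (gaussMap_mem_Ioo hyi)
      (irrational_gaussMap hyi) fun k hk => by
        rw [pq_gaussMap, pq_gaussMap]
        exact h (k + 1) (by omega)
    simp only [pq_gaussMap] at hT
    rw [Finset.prod_range_succ']
    have ha : (1 : ℝ) ≤ pq x 1 := by exact_mod_cast one_le_pq_one hx
    have hxa := one_div_eq_pq_add_gaussMap hx
    have hya := one_div_eq_pq_add_gaussMap hy
    rw [← h 0 (by omega)] at hya
    have hTx := gaussMap_mem_Ioo hxi
    have hTy := gaussMap_mem_Ioo hyi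
    simp only [zero_add] at hya ⊢
    set a : ℝ := ((pq x 1 : ℕ) : ℝ)
    set u := gaussMap x
    set v := gaussMap y
    have hx' : x = 1 / (a + u) := by rw [← hxa, one_div_one_div]
    have hy' : y = 1 / (a + v) := by rw [← hya, one_div_one_div]
    have hu : 0 < a + u := by linarith [hTx.1]
    have hv : 0 < a + v := by linarith [hTy.1]
    have hsub : x - y = -((u - v) * ((a + u) * (a + v))⁻¹) := by
      rw [hx', hy']
      field_simp
      ring
    rw [hsub, abs_neg, abs_mul, abs_of_nonneg (inv_nonneg.2 (mul_pos hu hv).le)]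
    refine mul_le_mul hT ?_ (inv_nonneg.2 (mul_pos hu hv).le)
      (Finset.prod_nonneg fun _ _ => by positivity)
    refine inv_anti₀ (by positivity) ?_
    nlinarith [hTx.1, hTy.1]

/-- The weight `a ^ (-t)` of a partial quotient `a`. -/
noncomputable def quotientWeight (t : ℝ) (a : ℕ) : ℝ≥0∞ := ENNReal.ofReal ((a : ℝ) ^ (-t))

/-- `E` is covered by countably many cylinders of order `m` of total weight at most `c`. -/
def HasWordCover (E : Set ℝ) (t : ℝ) (m : ℕ) (c : ℝ≥0∞) : Prop :=
  ∃ (ι : Type) (_ : Countable ι) (w : ι → ℕ → ℕ),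
    (∀ x ∈ E, ∃ i, ∀ k < m, pq x (k + 1) = w i k) ∧
      ∑' i, ∏ k ∈ Finset.range m, quotientWeight t (w i k) ≤ c

theorem HasWordCover.append {E : Set ℝ} {t : ℝ} {m l : ℕ} {c r : ℝ≥0∞}
    (h : HasWordCover E t m c) {κ : Type} [Countable κ] (v : κ → ℕ → ℕ)
    (hv : ∀ x ∈ E, ∃ j, ∀ k < l, pq x (m + k + 1) = v j k)
    (hr : ∑' j, ∏ k ∈ Finset.range l, quotientWeight t (v j k) ≤ r) :
    HasWordCover E t (m + l) (c * r) := by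
  obtain ⟨ι, hι, w, hw, hc⟩ := h
  refine ⟨ι × κ, inferInstance, fun p k => if k < m then w p.1 k else v p.2 (k - m), ?_, ?_⟩
  · intro x hx
    obtain ⟨i, hi⟩ := hw x hx
    obtain ⟨j, hj⟩ := hv x hx
    refine ⟨(i, j), fun k hk => ?_⟩
    by_cases hkm : k < m
    · simp [hkm, hi k hkm]
    · have := hj (k - m) (by omega)
      rw [Nat.add_sub_cancel' (by omega)] at this
      simp [hkm, this]
  · have hsplit : ∀ p : ι × κ, ∏ k ∈ Finset.range (m + l),
        quotientWeight t (if k < m then w p.1 k else v p.2 (k - m)) =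
        (∏ k ∈ Finset.range m, quotientWeight t (w p.1 k)) *
          ∏ k ∈ Finset.range l, quotientWeight t (v p.2 k) := by
      intro p
      rw [Finset.prod_range_add]
      congr 1
      · refine Finset.prod_congr rfl fun k hk => ?_
        simp [Finset.mem_range.1 hk]
      · refine Finset.prod_congr rfl fun k _ => ?_
        simp
    simp only [hsplit]
    rw [ENNReal.tsum_prod']
    simp only [ENNReal.tsum_mul_left, ENNReal.tsum_mul_right]
    gcongr

/-- Cylinder covers whose total weight tends to zero force Hausdorff measure zero. -/
theorem hausdorffMeasure_eq_zero_of_hasWordCover {E : Set ℝ}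
    (hE : ∀ x ∈ E, x ∈ Ioo (0 : ℝ) 1 ∧ Irrational x) {s : ℝ} (hs : 0 < s) (m : ℕ → ℕ)
    (c : ℕ → ℝ≥0∞) (hc : Tendsto c atTop (𝓝 0))
    (h : ∀ j, HasWordCover E (2 * s) (m j) (c j)) :
    Measure.hausdorffMeasure s E = 0 := by
  choose ι hι w hw hsum using h
  have hdiam : ∀ j i, Metric.ediam {x ∈ E | ∀ k < m j, pq x (k + 1) = w j i k} ^ s ≤
      ∏ k ∈ Finset.range (m j), quotientWeight (2 * s) (w j i k) := by
    intro j i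
    have hle : Metric.ediam {x ∈ E | ∀ k < m j, pq x (k + 1) = w j i k} ≤
        ENNReal.ofReal (∏ k ∈ Finset.range (m j), ((w j i k : ℝ) ^ 2)⁻¹) := by
      refine Metric.ediam_le_of_forall_dist_le fun x hx y hy => ?_
      have hxE := hE x hx.1
      have hyE := hE y hy.1
      rw [Real.dist_eq]
      refine (abs_sub_le_prod_pq (m j) hxE.1 hxE.2 hyE.1 hyE.2 fun k hk => by
        rw [hx.2 k hk, hy.2 k hk]).trans (le_of_eq ?_)
      refine Finset.prod_congr rfl fun k hk => ?_
      rw [hx.2 k (Finset.mem_range.1 hk)]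
    refine (ENNReal.rpow_le_rpow hle hs.le).trans (le_of_eq ?_)
    rw [ENNReal.ofReal_rpow_of_nonneg (Finset.prod_nonneg fun _ _ => by positivity) hs.le,
      ← Real.finsetProd_rpow _ _ (fun _ _ => by positivity),
      ENNReal.ofReal_prod_of_nonneg fun _ _ => by positivity]
    refine Finset.prod_congr rfl fun k _ => ?_
    rw [quotientWeight, Real.rpow_neg (Nat.cast_nonneg _), Real.rpow_mul (Nat.cast_nonneg _),
      Real.inv_rpow (by positivity), Real.rpow_two]
  have hlim : Tendsto (fun j => c j ^ (1 / s)) atTop (𝓝 0) := by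
    have := (ENNReal.continuous_rpow_const (y := 1 / s)).tendsto 0 |>.comp hc
    rwa [ENNReal.zero_rpow_of_pos (by positivity)] at this
  have hbound := Measure.hausdorffMeasure_le_liminf_tsum s E (fun j => c j ^ (1 / s)) hlim
    (fun j i => {x ∈ E | ∀ k < m j, pq x (k + 1) = w j i k})
    (Eventually.of_forall fun j i => by
      rw [one_div, ENNReal.le_rpow_inv_iff hs]
      exact (hdiam j i).trans ((ENNReal.le_tsum i).trans (hsum j)))
    (Eventually.of_forall fun j x hx => by
      obtain ⟨i, hi⟩ := hw j x hx
      exact mem_iUnion.2 ⟨i, hx, hi⟩)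
  refine le_antisymm (hbound.trans ?_) zero_le
  rw [← hc.liminf_eq]
  exact liminf_le_liminf (Eventually.of_forall fun j =>
    (ENNReal.tsum_le_tsum (hdiam j)).trans (hsum j))

theorem sum_rpow_neg_le {t : ℝ} (ht0 : 0 < t) (ht1 : t < 1) (M : ℕ) :
    ∑ i ∈ Finset.range M, ((i + 1 : ℕ) : ℝ) ^ (-t) ≤ (1 - t)⁻¹ * (M : ℝ) ^ (1 - t) := by
  induction M with
  | zero => simp [Real.zero_rpow (by linarith : (1 - t) ≠ 0)]
  | succ M ih =>
    rw [Finset.sum_range_succ]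
    have hp : 0 < 1 - t := by linarith
    set b : ℝ := ((M + 1 : ℕ) : ℝ) with hb
    have hb1 : 1 ≤ b := by rw [hb]; exact_mod_cast Nat.le_add_left 1 M
    have hM : (M : ℝ) = b * (1 + -b⁻¹) := by
      rw [hb]; push_cast; field_simp; ring
    have hinv : b⁻¹ ≤ 1 := inv_le_one_of_one_le₀ hb1
    have hbern : (1 + -b⁻¹) ^ (1 - t) ≤ 1 + (1 - t) * -b⁻¹ :=
      rpow_one_add_le_one_add_mul_self (by linarith) hp.le (by linarith)
    have hMle : (M : ℝ) ^ (1 - t) ≤ b ^ (1 - t) - (1 - t) * b ^ (-t) := by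
      rw [hM, Real.mul_rpow (by linarith) (by linarith)]
      have hbt : b ^ (-t) = b ^ (1 - t) * b⁻¹ := by
        rw [← Real.rpow_neg_one b, ← Real.rpow_add (by linarith)]
        ring_nf
      calc b ^ (1 - t) * (1 + -b⁻¹) ^ (1 - t)
          ≤ b ^ (1 - t) * (1 + (1 - t) * -b⁻¹) := by gcongr
        _ = b ^ (1 - t) - (1 - t) * b ^ (-t) := by rw [hbt]; ring
    calc _ ≤ (1 - t)⁻¹ * (M : ℝ) ^ (1 - t) + b ^ (-t) := by gcongr
      _ ≤ (1 - t)⁻¹ * (b ^ (1 - t) - (1 - t) * b ^ (-t)) + b ^ (-t) := by gcongr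
      _ = (1 - t)⁻¹ * b ^ (1 - t) := by field_simp; ring

theorem sum_quotientWeight_le {t : ℝ} (ht0 : 0 < t) (ht1 : t < 1) (M : ℕ) :
    ∑ i : Fin M, quotientWeight t (i + 1) ≤ ENNReal.ofReal ((1 - t)⁻¹ * (M : ℝ) ^ (1 - t)) := by
  rw [Fin.sum_univ_eq_sum_range (fun i => quotientWeight t (i + 1))]
  unfold quotientWeight
  rw [← ENNReal.ofReal_sum_of_nonneg fun _ _ => by positivity]
  exact ENNReal.ofReal_le_ofReal (sum_rpow_neg_le ht0 ht1 M)

theorem quotientWeight_anti {t : ℝ} (ht : 0 < t) {a b : ℕ} (ha : 0 < a) (hab : a ≤ b) :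
    quotientWeight t b ≤ quotientWeight t a := by
  refine ENNReal.ofReal_le_ofReal ?_
  exact Real.rpow_le_rpow_of_nonpos (by exact_mod_cast ha) (by exact_mod_cast hab) (by linarith)

theorem prod_quotientWeight_progression_le {t : ℝ} (ht : 0 < t) {M d q c : ℕ} (hM : 0 < M)
    (hd : 0 < d) (hq : 0 < q) :
    ∏ i ∈ Finset.range (q + c), quotientWeight t (M + i * d) ≤
      quotientWeight t M ^ q * quotientWeight t d ^ c := by
  rw [Finset.prod_range_add]
  refine mul_le_mul' ?_ ?_
  · refine (Finset.prod_le_pow_card _ _ _ fun i _ =>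
      quotientWeight_anti ht hM (Nat.le_add_right M _)).trans (by simp)
  · refine (Finset.prod_le_pow_card _ _ _ fun i _ => quotientWeight_anti ht hd ?_).trans (by simp)
    nlinarith [Nat.mul_le_mul_right d (show 1 ≤ q + i by omega)]

/-- `K` free entries at most `p.1 + n + 1`, followed by the progression with first term
`p.1 + n + 1` and difference `p.2 + 1`. -/
def blockWord (K n : ℕ) (j : Σ p : ℕ × ℕ, (Fin K → Fin (p.1 + n + 1))) (k : ℕ) : ℕ :=
  if h : k < K then j.2 ⟨k, h⟩ + 1 else (j.1.1 + n + 1) + (k - K) * (j.1.2 + 1)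

theorem tsum_blockWord (t : ℝ) (K n l : ℕ) :
    ∑' j, ∏ k ∈ Finset.range (K + l), quotientWeight t (blockWord K n j k) =
      ∑' p : ℕ × ℕ, (∑ i : Fin (p.1 + n + 1), quotientWeight t (i + 1)) ^ K *
        ∏ i ∈ Finset.range l, quotientWeight t (p.1 + n + 1 + i * (p.2 + 1)) := by
  refine (ENNReal.tsum_sigma' _).trans ?_
  congr 1
  funext p
  rw [tsum_fintype, Fintype.sum_pow, Finset.sum_mul]
  refine Finset.sum_congr rfl fun f _ => ?_
  rw [Finset.prod_range_add, Finset.prod_range]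
  congr 1
  · refine Finset.prod_congr rfl fun k _ => ?_
    simp [blockWord]
  · refine Finset.prod_congr rfl fun k _ => ?_
    simp [blockWord]

theorem eventually_block_bound {t β : ℝ} (hβ : 1 ≤ β) (htβ : β - 1 < t * β)
    (c : ℕ) (K : ℕ → ℕ) (hK : Tendsto (fun n => (K n : ℝ) / n) atTop (𝓝 (β - 1)))
    (C : ℝ) (hC : 0 ≤ C) :
    ∀ᶠ n : ℕ in atTop, ∀ M : ℝ, (n : ℝ) ≤ M →
      (C * M ^ (1 - t)) ^ K n * (M ^ (-t)) ^ (n + 1 - c) ≤ M ^ (-3 : ℝ) := by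
  set δ : ℝ := (t * β - (β - 1)) / (2 * β) with hδ
  have hβ0 : 0 < β := by linarith
  have hδ0 : 0 < δ := div_pos (by linarith) (by linarith)
  have hδβ : 2 * (δ * β) = t * β - (β - 1) := by rw [hδ]; field_simp
  have hneg : (1 - t + δ) * (β - 1) - t < 0 := by nlinarith
  have hlim : Tendsto (fun n : ℕ => (1 - t + δ) * ((K n : ℝ) / n) - t +
      (t * c + 3 + |t|) / n) atTop (𝓝 ((1 - t + δ) * (β - 1) - t + 0)) :=
    ((hK.const_mul _).sub_const t).add (tendsto_const_div_atTop_nhds_zero_nat _)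
  rw [add_zero] at hlim
  have hCev : ∀ᶠ M : ℝ in atTop, C ≤ M ^ δ := (tendsto_rpow_atTop hδ0).eventually_ge_atTop C
  obtain ⟨M₀, hM₀⟩ := eventually_atTop.1 hCev
  filter_upwards [hlim.eventually_lt_const hneg, eventually_ge_atTop (max 1 c),
    eventually_ge_atTop ⌈M₀⌉₊] with n hn hn1 hnM M hM
  have hn1' : 1 ≤ n := (le_max_left _ _).trans hn1
  have hnc : c ≤ n := (le_max_right _ _).trans hn1
  have hnpos : (0 : ℝ) < n := by exact_mod_cast hn1'
  have hM1 : 1 ≤ M := le_trans (by exact_mod_cast hn1') hM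
  have hM0 : 0 < M := by linarith
  have hCM : C ≤ M ^ δ := hM₀ M ((Nat.ceil_le.1 hnM).trans hM)
  have hexp : (1 - t + δ) * K n + -t * ((n + 1 - c : ℕ) : ℝ) ≤ -3 := by
    have h1 := mul_neg_of_neg_of_pos hn hnpos
    have h2 : ((1 - t + δ) * ((K n : ℝ) / n) - t + (t * c + 3 + |t|) / n) * n =
        (1 - t + δ) * K n - t * n + (t * c + 3 + |t|) := by
      field_simp
    rw [h2] at h1
    rw [Nat.cast_sub (by omega)]
    push_cast
    nlinarith [neg_abs_le t]
  calc (C * M ^ (1 - t)) ^ K n * (M ^ (-t)) ^ (n + 1 - c)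
      ≤ (M ^ δ * M ^ (1 - t)) ^ K n * (M ^ (-t)) ^ (n + 1 - c) := by gcongr
    _ = M ^ ((1 - t + δ) * K n + -t * ((n + 1 - c : ℕ) : ℝ)) := by
      rw [← Real.rpow_add hM0, ← Real.rpow_mul_natCast hM0.le, ← Real.rpow_mul_natCast hM0.le,
        ← Real.rpow_add hM0, add_comm δ]
    _ ≤ M ^ (-3 : ℝ) := Real.rpow_le_rpow_of_exponent_le hM1 hexp

theorem eventually_tsum_blockWord_le {t β : ℝ} (ht0 : 0 < t) (ht1 : t < 1) (hβ : 1 ≤ β)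
    (htβ : β - 1 < t * β) (K : ℕ → ℕ)
    (hK : Tendsto (fun n => (K n : ℝ) / n) atTop (𝓝 (β - 1))) :
    ∀ᶠ n : ℕ in atTop, ∑' j, ∏ k ∈ Finset.range (K n + (n + 1)),
      quotientWeight t (blockWord (K n) n j k) ≤ 2⁻¹ := by
  obtain ⟨c, hc⟩ := exists_nat_ge (2 / t)
  have hct : 2 ≤ t * c := by
    rw [div_le_iff₀ ht0] at hc
    linarith
  set Z : ℝ≥0∞ := ∑' m : ℕ, ENNReal.ofReal (((m + 1 : ℕ) : ℝ) ^ (-2 : ℝ)) with hZ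
  have hZfin : Z ≠ ∞ := by
    have hsum : Summable fun m : ℕ => ((m + 1 : ℕ) : ℝ) ^ (-2 : ℝ) :=
      (summable_nat_add_iff 1).2 (Real.summable_nat_rpow.2 (by norm_num))
    rw [hZ, ← ENNReal.ofReal_tsum_of_nonneg (fun _ => by positivity) hsum]
    exact ENNReal.ofReal_ne_top
  have hsmall : Tendsto (fun n : ℕ => ENNReal.ofReal ((n : ℝ)⁻¹) * (Z * Z)) atTop (𝓝 0) := by
    have h0 : Tendsto (fun n : ℕ => ENNReal.ofReal ((n : ℝ)⁻¹)) atTop (𝓝 0) := by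
      simpa using ENNReal.tendsto_ofReal tendsto_inv_atTop_nhds_zero_nat
    simpa using ENNReal.Tendsto.mul_const h0 (Or.inr (ENNReal.mul_ne_top hZfin hZfin))
  filter_upwards [eventually_block_bound hβ htβ c K hK (1 - t)⁻¹
    (inv_nonneg.2 (by linarith)), eventually_ge_atTop (c + 1),
    hsmall.eventually_le_const (show (0 : ℝ≥0∞) < 2⁻¹ by simp)] with n hn hnc hn2
  rw [tsum_blockWord]
  refine le_trans ?_ hn2
  rw [hZ, ← ENNReal.tsum_mul_left, ← ENNReal.tsum_mul_left, ENNReal.tsum_prod']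
  refine ENNReal.tsum_le_tsum fun m => ?_
  rw [← ENNReal.tsum_mul_right, ← ENNReal.tsum_mul_left]
  refine ENNReal.tsum_le_tsum fun d => ?_
  set M := m + n + 1 with hM
  have hM0 : (0 : ℝ) < M := by rw [hM]; positivity
  have hn0 : (0 : ℝ) < n := by exact_mod_cast (by omega : 0 < n)
  have hprog := prod_quotientWeight_progression_le (M := M) (d := d + 1) (q := n + 1 - c)
    (c := c) ht0 (by omega) (by omega) (by omega)
  rw [show n + 1 - c + c = n + 1 by omega] at hprog
  have hd : quotientWeight t (d + 1) ^ c ≤ ENNReal.ofReal (((d + 1 : ℕ) : ℝ) ^ (-2 : ℝ)) := by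
    rw [quotientWeight, ← ENNReal.ofReal_pow (by positivity),
      ← Real.rpow_mul_natCast (by positivity)]
    refine ENNReal.ofReal_le_ofReal (Real.rpow_le_rpow_of_exponent_le ?_ (by linarith))
    exact_mod_cast Nat.le_add_left 1 d
  have hcube : (M : ℝ) ^ (-3 : ℝ) ≤ (n : ℝ)⁻¹ * ((m + 1 : ℕ) : ℝ) ^ (-2 : ℝ) := by
    rw [show (-3 : ℝ) = -1 + -2 by norm_num, Real.rpow_add hM0, Real.rpow_neg_one]
    refine mul_le_mul (inv_anti₀ hn0 (by exact_mod_cast (by omega : n ≤ M))) ?_ (by positivity)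
      (by positivity)
    exact Real.rpow_le_rpow_of_nonpos (by positivity) (by exact_mod_cast (by omega : m + 1 ≤ M))
      (by norm_num)
  have hfree : (∑ i : Fin M, quotientWeight t (i + 1)) ^ K n * quotientWeight t M ^ (n + 1 - c) ≤
      ENNReal.ofReal ((n : ℝ)⁻¹) * ENNReal.ofReal (((m + 1 : ℕ) : ℝ) ^ (-2 : ℝ)) := by
    calc _ ≤ ENNReal.ofReal ((1 - t)⁻¹ * (M : ℝ) ^ (1 - t)) ^ K n *
          quotientWeight t M ^ (n + 1 - c) := by
          gcongr
          exact sum_quotientWeight_le ht0 ht1 M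
      _ = ENNReal.ofReal (((1 - t)⁻¹ * (M : ℝ) ^ (1 - t)) ^ K n *
          ((M : ℝ) ^ (-t)) ^ (n + 1 - c)) := by
          have h1t : 0 ≤ (1 - t)⁻¹ := inv_nonneg.2 (by linarith)
          rw [quotientWeight, ENNReal.ofReal_mul (p := _ ^ K n) (by positivity),
            ENNReal.ofReal_pow (by positivity),
            ENNReal.ofReal_pow (by positivity)]
      _ ≤ ENNReal.ofReal ((n : ℝ)⁻¹ * ((m + 1 : ℕ) : ℝ) ^ (-2 : ℝ)) :=
          ENNReal.ofReal_le_ofReal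
            ((hn M (by exact_mod_cast (by omega : n ≤ M))).trans hcube)
      _ = _ := ENNReal.ofReal_mul (by positivity)
  calc _ ≤ (∑ i : Fin M, quotientWeight t (i + 1)) ^ K n *
        (quotientWeight t M ^ (n + 1 - c) * quotientWeight t (d + 1) ^ c) := by gcongr
    _ = ((∑ i : Fin M, quotientWeight t (i + 1)) ^ K n * quotientWeight t M ^ (n + 1 - c)) *
        quotientWeight t (d + 1) ^ c := (mul_assoc _ _ _).symm
    _ ≤ (ENNReal.ofReal ((n : ℝ)⁻¹) * ENNReal.ofReal (((m + 1 : ℕ) : ℝ) ^ (-2 : ℝ))) *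
        ENNReal.ofReal (((d + 1 : ℕ) : ℝ) ^ (-2 : ℝ)) := by gcongr
    _ = _ := by ring

theorem exists_blockWord_eq {b : ℕ → ℕ} (hb1 : 1 ≤ b 1)
    (hb : ∀ n, 1 ≤ n → b n < b (n + 1)) {K n L : ℕ} (hn : 1 ≤ n) (hL : n ≤ L)
    (hAP : IsAPAt b (L + K + 1) (n + 1)) :
    ∃ j, ∀ k < K + (n + 1), b (L + k + 1) = blockWord K n j k := by
  have hge : ∀ k, k + 1 ≤ b (k + 1) := by
    intro k
    induction k with
    | zero => exact hb1
    | succ k ih => exact lt_of_le_of_lt ih (hb (k + 1) (by omega))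
  have hlt : ∀ i k, 1 ≤ i → b i < b (i + k + 1) := by
    intro i k hi
    induction k with
    | zero => exact hb i hi
    | succ k ih => exact ih.trans (hb _ (by omega))
  set M := b (L + K + 1) with hM
  have hMn : n + 1 ≤ M := le_trans (by omega) (hge (L + K))
  obtain ⟨d, hd⟩ := hAP
  have hd0 : 0 < d := by
    have h0 := hd 0 (by omega)
    have h1 := hlt (L + K + 1) 0 (by omega)
    simp only [add_zero] at h0 h1
    omega
  have hval : ∀ i, i ≤ n → (b (L + K + 1 + i) : ℤ) = M + i * d := by
    intro i hi
    induction i with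
    | zero => simp [hM]
    | succ i ih =>
      have h0 := hd i (by omega)
      have h1 := ih (by omega)
      rw [← add_assoc]
      push_cast
      linarith
  have hfree : ∀ k : Fin K, b (L + k + 1) - 1 < M - (n + 1) + n + 1 := by
    intro k
    have h0 := hlt (L + k + 1) (K - k - 1) (by omega)
    rw [show L + k + 1 + (K - k - 1) + 1 = L + K + 1 by omega] at h0
    omega
  refine ⟨⟨(M - (n + 1), d.toNat - 1), fun k => ⟨b (L + k + 1) - 1, hfree k⟩⟩, fun k hk => ?_⟩
  unfold blockWord
  split_ifs with hkK
  · have := hge (L + k)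
    simp only
    omega
  · obtain ⟨i, rfl⟩ := Nat.exists_eq_add_of_le (not_lt.1 hkK)
    have h0 := hval i (by omega)
    have h1 : ((d.toNat - 1 + 1 : ℕ) : ℤ) = d := by omega
    rw [show L + (K + i) + 1 = L + K + 1 + i by omega, Nat.add_sub_cancel_left]
    zify
    rw [h0]
    push_cast at h1 ⊢
    rw [h1, Nat.cast_sub hMn]
    push_cast
    ring

/-- Proposition 3.2 (upper bound): `dim_H G((σ_n)) ≤ (β-1)/(2β)` where
`β = lim (σ_{n+1} - σ_n)/n < ∞`. -/
theorem stmt5 (σ : ℕ → ℕ) (hσ1 : 1 ≤ σ 1)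
    (hmono : ∀ n : ℕ, 1 ≤ n → σ n < σ (n + 1))
    (hgap : ∀ n : ℕ, 1 ≤ n → n ≤ σ (n + 1) - σ n)
    (β : ℝ) (hβ : 1 ≤ β)
    (hlim : Filter.Tendsto (fun n : ℕ => ((σ (n + 1) - σ n : ℕ) : ℝ) / (n : ℝ))
      Filter.atTop (nhds β)) :
    dimH (Gset σ) ≤ ENNReal.ofReal ((β - 1) / (2 * β)) := by
  set K : ℕ → ℕ := fun n => σ (n + 1) - σ n - n with hKdef
  have hK : Tendsto (fun n => (K n : ℝ) / n) atTop (𝓝 (β - 1)) := by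
    refine (hlim.sub_const 1).congr' ?_
    filter_upwards [eventually_ge_atTop 1] with n hn
    have hn0 : (0 : ℝ) < n := by exact_mod_cast hn
    rw [hKdef, Nat.cast_sub (hgap n hn), sub_div, div_self hn0.ne']
  have hσ : ∀ n, 1 ≤ n → 1 ≤ σ n := by
    intro n hn
    induction n, hn using Nat.le_induction with
    | base => exact hσ1
    | succ n hn ih => exact ih.trans (hmono n hn).le
  have hβ0 : 0 < β := by linarith
  refine le_of_forall_gt_imp_ge_of_dense fun a ha => ?_
  obtain ⟨s, hbs, hsa⟩ := ENNReal.lt_iff_exists_nnreal_btwn.1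
    (lt_min ha (show ENNReal.ofReal ((β - 1) / (2 * β)) < ENNReal.ofReal (1 / 2) by
      rw [ENNReal.ofReal_lt_ofReal_iff (by norm_num), div_lt_div_iff₀ (by positivity) (by norm_num)]
      linarith))
  have hs1 : (s : ℝ) < 1 / 2 := by
    have := hsa.trans_le (min_le_right _ _)
    rwa [← ENNReal.ofReal_coe_nnreal, ENNReal.ofReal_lt_ofReal_iff (by norm_num)] at this
  have hs0 : (0 : ℝ) < s := by
    have := zero_le.trans_lt hbs
    exact_mod_cast this
  have hsβ : β - 1 < 2 * s * β := by
    rw [← ENNReal.ofReal_coe_nnreal, ENNReal.ofReal_lt_ofReal_iff hs0,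
      div_lt_iff₀ (by positivity)] at hbs
    linarith
  refine le_trans ?_ (hsa.trans_le (min_le_left _ _)).le
  obtain ⟨N₀, hN₀⟩ := eventually_atTop.1 (eventually_tsum_blockWord_le (t := 2 * s)
    (by linarith) (by linarith) hβ hsβ K hK)
  set L : ℕ → ℕ := fun n => σ n + n - 1 with hL
  set E : (Σ N : ℕ, Fin (L (N₀ + 1 + N)) → ℕ) → Set ℝ := fun p =>
    {x | x ∈ Jset ∧ (∀ n, N₀ + 1 + p.1 ≤ n → IsAPAt (pq x) (σ n) n) ∧
      ∀ k : Fin (L (N₀ + 1 + p.1)), pq x (k + 1) = p.2 k}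
  have hcover : Gset σ ⊆ ⋃ p, E p := by
    rintro x ⟨hxJ, N, hN⟩
    exact mem_iUnion.2 ⟨⟨N, fun k => pq x (k + 1)⟩, hxJ, fun n hn => hN n (by simp only at hn; omega),
      fun k => rfl⟩
  refine (dimH_mono hcover).trans ?_
  rw [dimH_iUnion]
  refine iSup_le fun p => dimH_le_of_hausdorffMeasure_ne_top ?_
  obtain ⟨N, v⟩ := p
  set c₀ : ℝ≥0∞ := ∏ k ∈ Finset.range (L (N₀ + 1 + N)),
    quotientWeight (2 * s) (if h : k < L (N₀ + 1 + N) then v ⟨k, h⟩ else 0) with hc₀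
  have hc₀fin : c₀ ≠ ∞ := ENNReal.prod_ne_top fun _ _ => ENNReal.ofReal_ne_top
  have hword : ∀ j, HasWordCover (E ⟨N, v⟩) (2 * s) (L (N₀ + 1 + N + j)) (c₀ * 2⁻¹ ^ j) := by
    intro j
    induction j with
    | zero =>
      refine ⟨Unit, inferInstance,
        fun _ k => if h : k < L (N₀ + 1 + N) then v ⟨k, h⟩ else 0, ?_, ?_⟩
      · intro x hx
        refine ⟨(), fun k hk => ?_⟩
        have hk' : k < L (N₀ + 1 + N) := hk
        simpa only [dif_pos hk'] using hx.2.2 ⟨k, hk'⟩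
      · simp [hc₀]
    | succ j ih =>
      set n := N₀ + 1 + N + j with hn
      have h1 := hσ n (by omega)
      have h2 := hgap n (by omega)
      have h3 := hmono n (by omega)
      have hLK : L n + K n + 1 = σ (n + 1) := by
        simp only [hL, hKdef]
        omega
      have hLsucc : L (n + 1) = L n + (K n + (n + 1)) := by
        have : L (n + 1) = σ (n + 1) + n := by simp only [hL]; omega
        omega
      rw [pow_succ, ← mul_assoc, show N₀ + 1 + N + (j + 1) = n + 1 by omega, hLsucc]
      refine ih.append (blockWord (K n) n) (fun x hx => ?_) (hN₀ n (by omega))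
      refine exists_blockWord_eq (one_le_pq_one hx.1.1) hx.1.2.2 (by omega)
        (by simp only [hL]; omega) ?_
      rw [hLK]
      exact hx.2.1 (n + 1) (by simp only; omega)
  have hzero : Tendsto (fun j : ℕ => c₀ * 2⁻¹ ^ j) atTop (𝓝 0) := by
    simpa using ENNReal.Tendsto.const_mul
      (ENNReal.tendsto_pow_atTop_nhds_zero_of_lt_one (r := 2⁻¹) (by simp)) (Or.inr hc₀fin)
  rw [hausdorffMeasure_eq_zero_of_hasWordCover (fun x hx => ⟨hx.1.1, hx.1.2.1⟩) hs0 _ _ hzero hword]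
  exact ENNReal.zero_ne_top
end

section
/- Let (σ_n)_{n≥1} be a strictly increasing sequence of positive integers with σ_{n+1} − σ_n ≥ n for all n ≥ 1 and such that (σ_{n+1} − σ_n)/n converges to a finite limit β ≥ 1 as n → ∞. Then the Hausdorff dimension of G((σ_n)) is at least (β−1)/(2β). -/
open Filter MeasureTheory Set
open scoped ENNReal NNReal Topology

/-- The finite continued fraction `[0; a 0, …, a (n-1)]`. -/
noncomputable def cfApprox : ℕ → (ℕ → ℕ) → ℝ
  | 0, _ => 0
  | n + 1, a => 1 / (a 0 + cfApprox n (fun k => a (k + 1)))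

/-- The infinite continued fraction `[0; a 0, a 1, …]`. -/
noncomputable def cfValue (a : ℕ → ℕ) : ℝ := limUnder atTop (fun n => cfApprox n a)

lemma one_div_add_mem_Icc {p : ℕ} (hp : 2 ≤ p) {z : ℝ} (hz : 0 ≤ z) :
    1 / (p + z) ∈ Icc (0 : ℝ) (1 / 2) := by
  have hp' : (2 : ℝ) ≤ p := by exact_mod_cast hp
  exact ⟨by positivity, one_div_le_one_div_of_le (by norm_num) (by linarith)⟩

lemma abs_one_div_add_sub (p q : ℕ) {z w : ℝ} (hz : 0 < p + z) (hw : 0 < q + w) :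
    |1 / (p + z) - 1 / (q + w)| = |(q + w) - (p + z)| / ((p + z) * (q + w)) := by
  rw [div_sub_div _ _ hz.ne' hw.ne', abs_div, abs_of_pos (mul_pos hz hw)]
  ring_nf

lemma cfApprox_mem_Icc (n : ℕ) {a : ℕ → ℕ} (ha : ∀ k, 2 ≤ a k) :
    cfApprox n a ∈ Icc (0 : ℝ) (1 / 2) := by
  induction n generalizing a with
  | zero => simp [cfApprox]
  | succ n ih => exact one_div_add_mem_Icc (ha 0) (ih fun k => ha (k + 1)).1

lemma dist_cfApprox_succ_le (n : ℕ) {a : ℕ → ℕ} (ha : ∀ k, 2 ≤ a k) :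
    dist (cfApprox n a) (cfApprox (n + 1) a) ≤ 1 / 2 * (1 / 4 : ℝ) ^ n := by
  induction n generalizing a with
  | zero =>
    have h := cfApprox_mem_Icc 1 ha
    rw [Real.dist_eq, abs_sub_comm, show cfApprox 0 a = 0 from rfl, sub_zero, abs_of_nonneg h.1]
    simpa using h.2
  | succ n ih =>
    have ha' : ∀ k, 2 ≤ a (k + 1) := fun k => ha (k + 1)
    have hz := (cfApprox_mem_Icc n ha').1
    have hw := (cfApprox_mem_Icc (n + 1) ha').1
    have h := ih ha'
    have hp : (2 : ℝ) ≤ a 0 := by exact_mod_cast ha 0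
    rw [cfApprox, cfApprox, Real.dist_eq, abs_one_div_add_sub _ _ (by linarith) (by linarith),
      add_sub_add_left_eq_sub, abs_sub_comm, ← Real.dist_eq]
    calc _ ≤ (1 / 2 * (1 / 4 : ℝ) ^ n) / (2 * 2) := by gcongr <;> linarith
      _ = _ := by ring

lemma tendsto_cfApprox {a : ℕ → ℕ} (ha : ∀ k, 2 ≤ a k) :
    Tendsto (fun n => cfApprox n a) atTop (𝓝 (cfValue a)) :=
  tendsto_nhds_limUnder (cauchySeq_tendsto_of_complete
    (cauchySeq_of_le_geometric (1 / 4) (1 / 2) (by norm_num)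
      fun n => dist_cfApprox_succ_le n ha))

lemma cfValue_mem_Icc {a : ℕ → ℕ} (ha : ∀ k, 2 ≤ a k) : cfValue a ∈ Icc (0 : ℝ) (1 / 2) :=
  isClosed_Icc.mem_of_tendsto (tendsto_cfApprox ha)
    (Eventually.of_forall fun n => cfApprox_mem_Icc n ha)

lemma cfValue_eq {a : ℕ → ℕ} (ha : ∀ k, 2 ≤ a k) :
    cfValue a = 1 / (a 0 + cfValue (fun k => a (k + 1))) := by
  have ha' : ∀ k, 2 ≤ a (k + 1) := fun k => ha (k + 1)
  have hp : (2 : ℝ) ≤ a 0 := by exact_mod_cast ha 0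
  have hz := (cfValue_mem_Icc ha').1
  refine tendsto_nhds_unique ((tendsto_add_atTop_iff_nat 1).2 (tendsto_cfApprox ha)) ?_
  exact tendsto_const_nhds.div ((tendsto_cfApprox ha').const_add (a 0 : ℝ)) (by linarith)

lemma cfValue_pos {a : ℕ → ℕ} (ha : ∀ k, 2 ≤ a k) : 0 < cfValue a := by
  have hp : (2 : ℝ) ≤ a 0 := by exact_mod_cast ha 0
  have hz := (cfValue_mem_Icc fun k => ha (k + 1)).1
  rw [cfValue_eq ha]
  positivity

lemma one_div_cfValue {a : ℕ → ℕ} (ha : ∀ k, 2 ≤ a k) :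
    1 / cfValue a = a 0 + cfValue (fun k => a (k + 1)) := by
  rw [cfValue_eq ha, one_div_one_div]

lemma floor_one_div_cfValue {a : ℕ → ℕ} (ha : ∀ k, 2 ≤ a k) : ⌊1 / cfValue a⌋ = a 0 := by
  have hz := cfValue_mem_Icc fun k => ha (k + 1)
  rw [one_div_cfValue ha, Int.floor_eq_iff]
  push_cast
  exact ⟨by linarith [hz.1], by linarith [hz.2]⟩

lemma gaussMap_cfValue {a : ℕ → ℕ} (ha : ∀ k, 2 ≤ a k) :
    gaussMap (cfValue a) = cfValue (fun k => a (k + 1)) := by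
  rw [gaussMap, floor_one_div_cfValue ha, one_div_cfValue ha]
  push_cast
  ring

lemma gaussMap_iterate_cfValue (n : ℕ) {a : ℕ → ℕ} (ha : ∀ k, 2 ≤ a k) :
    gaussMap^[n] (cfValue a) = cfValue (fun k => a (k + n)) := by
  induction n generalizing a with
  | zero => rfl
  | succ n ih =>
    rw [Function.iterate_succ_apply, gaussMap_cfValue ha, ih fun k => ha (k + 1)]
    congr 1

lemma pq_cfValue (n : ℕ) {a : ℕ → ℕ} (ha : ∀ k, 2 ≤ a k) : pq (cfValue a) (n + 1) = a n := by
  rw [pq, Nat.add_sub_cancel, gaussMap_iterate_cfValue n ha,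
    floor_one_div_cfValue fun k => ha (k + n)]
  simp

lemma cfValue_mul_natCast_ne_natCast (d : ℕ) (hd : 0 < d) {a : ℕ → ℕ} (ha : ∀ k, 2 ≤ a k)
    (n : ℕ) : cfValue a * d ≠ n := by
  induction d using Nat.strong_induction_on generalizing a n with
  | _ d ih =>
    intro h
    have hd' : (0 : ℝ) < d := by exact_mod_cast hd
    have hpos := cfValue_pos ha
    have hn : (0 : ℝ) < n := h ▸ mul_pos hpos hd'
    have hnd : (n : ℝ) < d := by
      rw [← h]
      nlinarith [(cfValue_mem_Icc ha).2]
    have hz := (cfValue_mem_Icc fun k => ha (k + 1)).1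
    have hp : (0 : ℝ) ≤ a 0 := by positivity
    have h1 := one_div_cfValue ha
    have h2 : cfValue (fun k => a (k + 1)) * n = d - a 0 * n := by
      rw [← h]
      field_simp at h1
      linear_combination (-(d : ℝ)) * h1
    have hle : a 0 * n ≤ d := by
      have : (a 0 : ℝ) * n ≤ d := by nlinarith [mul_nonneg hz hn.le]
      exact_mod_cast this
    refine ih n (by exact_mod_cast hnd) (by exact_mod_cast hn) (fun k => ha (k + 1))
      (d - a 0 * n) ?_
    rw [h2]
    push_cast [hle]
    rfl

lemma irrational_cfValue {a : ℕ → ℕ} (ha : ∀ k, 2 ≤ a k) : Irrational (cfValue a) := by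
  rintro ⟨q, hq⟩
  have hq0 : 0 < q := by
    have := cfValue_pos ha
    rw [← hq] at this
    exact_mod_cast this
  refine cfValue_mul_natCast_ne_natCast q.den q.den_pos ha q.num.toNat ?_
  have h1 : ((q.num.toNat : ℤ) : ℝ) = q.num := by
    rw [Int.toNat_of_nonneg (Rat.num_pos.2 hq0).le]
  rw [← hq, ← Int.cast_natCast q.num.toNat, h1]
  exact_mod_cast Rat.mul_den_eq_num q

lemma prod_sq_inv_le_dist_cfValue {a b : ℕ → ℕ} (ha : ∀ k, 2 ≤ a k) (hb : ∀ k, 2 ≤ b k)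
    {M : ℕ → ℝ} (haM : ∀ k, a k + 1 ≤ M k) (hbM : ∀ k, b k + 1 ≤ M k) (n : ℕ)
    (heq : ∀ k < n, a k = b k) (hne : a n ≠ b n) :
    1 / 2 * (∏ k ∈ Finset.range (n + 1), M k)⁻¹ ^ 2 ≤ dist (cfValue a) (cfValue b) := by
  induction n generalizing a b M with
  | zero =>
    have hz := cfValue_mem_Icc fun k => ha (k + 1)
    have hw := cfValue_mem_Icc fun k => hb (k + 1)
    have hp : (2 : ℝ) ≤ a 0 := by exact_mod_cast ha 0
    have hq : (2 : ℝ) ≤ b 0 := by exact_mod_cast hb 0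
    have hd : (1 : ℝ) ≤ |(b 0 : ℝ) - a 0| := by
      have : (1 : ℤ) ≤ |(b 0 : ℤ) - a 0| := Int.one_le_abs (by omega)
      exact_mod_cast this
    rw [cfValue_eq ha, cfValue_eq hb, Real.dist_eq,
      abs_one_div_add_sub _ _ (by linarith [hz.1]) (by linarith [hw.1])]
    set z := cfValue fun k => a (k + 1)
    set w := cfValue fun k => b (k + 1)
    have hn : (1 / 2 : ℝ) ≤ |(b 0 + w) - (a 0 + z)| := by
      have h1 : |w - z| ≤ 1 / 2 := abs_le.2 ⟨by linarith [hw.1, hz.2], by linarith [hw.2, hz.1]⟩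
      have h2 := abs_sub_abs_le_abs_sub ((b 0 : ℝ) - a 0) (z - w)
      rw [abs_sub_comm z w] at h2
      rw [show (b 0 + w) - (a 0 + z) = (b 0 : ℝ) - a 0 - (z - w) by ring]
      linarith
    have := haM 0
    have := hbM 0
    calc _ = 1 / 2 / (M 0 * M 0) := by simp; ring
      _ ≤ _ := by
        have h1 : (0 : ℝ) < (a 0 + z) * (b 0 + w) :=
          mul_pos (by linarith [hz.1]) (by linarith [hw.1])
        have h2 : (a 0 + z) * (b 0 + w) ≤ M 0 * M 0 :=
          mul_le_mul (by linarith [hz.2]) (by linarith [hw.2]) (by linarith [hw.1])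
            (by linarith)
        gcongr
  | succ n ih =>
    have hz := cfValue_mem_Icc fun k => ha (k + 1)
    have hw := cfValue_mem_Icc fun k => hb (k + 1)
    have hp : (2 : ℝ) ≤ a 0 := by exact_mod_cast ha 0
    have h := ih (fun k => ha (k + 1)) (fun k => hb (k + 1)) (fun k => haM (k + 1))
      (fun k => hbM (k + 1)) (fun k hk => heq (k + 1) (by omega)) hne
    have h0 := heq 0 (by omega)
    rw [cfValue_eq ha, cfValue_eq hb, ← h0, Real.dist_eq,
      abs_one_div_add_sub _ _ (by linarith [hz.1]) (by linarith [hw.1]),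
      add_sub_add_left_eq_sub, abs_sub_comm, ← Real.dist_eq, Finset.prod_range_succ']
    set z := cfValue fun k => a (k + 1)
    set w := cfValue fun k => b (k + 1)
    have := haM 0
    have h1 : (0 : ℝ) < (a 0 + z) * (a 0 + w) :=
      mul_pos (by linarith [hz.1]) (by linarith [hw.1])
    have h2 : (a 0 + z) * (a 0 + w) ≤ M 0 * M 0 :=
      mul_le_mul (by linarith [hz.2]) (by linarith [hw.2]) (by linarith [hw.1]) (by linarith)
    calc _ = (1 / 2 * (∏ k ∈ Finset.range (n + 1), M (k + 1))⁻¹ ^ 2) / (M 0 * M 0) := by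
          rw [mul_inv]; ring
      _ ≤ _ := by gcongr

/-- The `n`-th remainder in the expansion of `y` in the mixed radix system with bases `N`. -/
noncomputable def radixRem (N : ℕ → ℕ) (y : ℝ) : ℕ → ℝ
  | 0 => y
  | n + 1 => Int.fract (N n * radixRem N y n)

/-- The `n`-th digit of `y` in the mixed radix system with bases `N`. -/
noncomputable def radixDigit (N : ℕ → ℕ) (y : ℝ) (n : ℕ) : ℕ := ⌊N n * radixRem N y n⌋₊

lemma radixRem_mem_Ico (N : ℕ → ℕ) {y : ℝ} (hy : y ∈ Ico (0 : ℝ) 1) (n : ℕ) :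
    radixRem N y n ∈ Ico (0 : ℝ) 1 := by
  cases n with
  | zero => exact hy
  | succ n => exact ⟨Int.fract_nonneg _, Int.fract_lt_one _⟩

lemma radixDigit_lt {N : ℕ → ℕ} {y : ℝ} (hy : y ∈ Ico (0 : ℝ) 1) {n : ℕ} (hN : 0 < N n) :
    radixDigit N y n < N n := by
  have h := radixRem_mem_Ico N hy n
  have hN' : (0 : ℝ) < N n := by exact_mod_cast hN
  rw [radixDigit, Nat.floor_lt (mul_nonneg hN'.le h.1)]
  nlinarith [h.2]

lemma radixRem_succ (N : ℕ → ℕ) {y : ℝ} (hy : y ∈ Ico (0 : ℝ) 1) (n : ℕ) :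
    radixRem N y (n + 1) = N n * radixRem N y n - radixDigit N y n := by
  have h := mul_nonneg (Nat.cast_nonneg (α := ℝ) (N n)) (radixRem_mem_Ico N hy n).1
  rw [radixRem, radixDigit, natCast_floor_eq_intCast_floor h, Int.self_sub_floor]

lemma sub_mul_prod_eq_radixRem_sub {N : ℕ → ℕ} {y z : ℝ} (hy : y ∈ Ico (0 : ℝ) 1)
    (hz : z ∈ Ico (0 : ℝ) 1) (n : ℕ) (h : ∀ k < n, radixDigit N y k = radixDigit N z k) :
    (y - z) * ∏ k ∈ Finset.range n, (N k : ℝ) = radixRem N y n - radixRem N z n := by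
  induction n with
  | zero => simp [radixRem]
  | succ n ih =>
    rw [Finset.prod_range_succ, radixRem_succ N hy, radixRem_succ N hz, h n (by omega),
      ← mul_assoc, ih fun k hk => h k (by omega)]
    ring

lemma dist_le_of_radixDigit_eq {N : ℕ → ℕ} (hN : ∀ k, 0 < N k) {y z : ℝ}
    (hy : y ∈ Ico (0 : ℝ) 1) (hz : z ∈ Ico (0 : ℝ) 1) (n : ℕ)
    (h : ∀ k < n, radixDigit N y k = radixDigit N z k) :
    dist y z ≤ (∏ k ∈ Finset.range n, (N k : ℝ))⁻¹ := by
  have hpos : 0 < ∏ k ∈ Finset.range n, (N k : ℝ) :=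
    Finset.prod_pos fun k _ => by exact_mod_cast hN k
  have h1 := radixRem_mem_Ico N hy n
  have h2 := radixRem_mem_Ico N hz n
  have h3 : |(y - z) * ∏ k ∈ Finset.range n, (N k : ℝ)| ≤ 1 := by
    rw [sub_mul_prod_eq_radixRem_sub hy hz n h]
    exact abs_le.2 ⟨by linarith [h1.1, h2.2], by linarith [h1.2, h2.1]⟩
  rwa [abs_mul, abs_of_pos hpos, ← le_div_iff₀ hpos, one_div, ← Real.dist_eq] at h3

lemma exists_radixDigit_ne {N : ℕ → ℕ} (hN : ∀ k, 0 < N k) {y z : ℝ}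
    (hy : y ∈ Ico (0 : ℝ) 1) (hz : z ∈ Ico (0 : ℝ) 1)
    (hlim : Tendsto (fun n => (∏ k ∈ Finset.range n, (N k : ℝ))⁻¹) atTop (𝓝 0)) (hyz : y ≠ z) :
    ∃ n, radixDigit N y n ≠ radixDigit N z n := by
  by_contra! h
  refine hyz (dist_le_zero.1 (ge_of_tendsto' hlim fun n => ?_))
  exact dist_le_of_radixDigit_eq hN hy hz n fun k _ => h k

/-- A map whose inverse is Hölder with exponent `s` on `[0, 1)` has an image of dimension at
least `s`. -/
lemma le_dimH_image_of_dist_le {g : ℝ → ℝ} {K s : ℝ≥0} (hs : 0 < s)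
    (h : ∀ y ∈ Ico (0 : ℝ) 1, ∀ z ∈ Ico (0 : ℝ) 1, dist y z ≤ K * dist (g y) (g z) ^ (s : ℝ)) :
    (s : ℝ≥0∞) ≤ dimH (g '' Ico 0 1) := by
  set f := Function.invFunOn g (Ico (0 : ℝ) 1)
  have hmem : ∀ y ∈ Ico (0 : ℝ) 1, f (g y) ∈ Ico (0 : ℝ) 1 ∧ g (f (g y)) = g y := fun y hy =>
    ⟨Function.invFunOn_mem ⟨y, hy, rfl⟩, Function.invFunOn_eq ⟨y, hy, rfl⟩⟩
  have hleft : ∀ y ∈ Ico (0 : ℝ) 1, f (g y) = y := fun y hy => by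
    have h1 := h _ (hmem y hy).1 y hy
    rw [(hmem y hy).2, dist_self, Real.zero_rpow (by positivity), mul_zero] at h1
    exact dist_le_zero.1 h1
  have hf : HolderOnWith K s f (g '' Ico 0 1) := by
    rintro _ ⟨y, hy, rfl⟩ _ ⟨z, hz, rfl⟩
    rw [hleft y hy, hleft z hz, edist_dist, edist_dist,
      ENNReal.ofReal_rpow_of_nonneg dist_nonneg s.coe_nonneg, ← ENNReal.ofReal_coe_nnreal,
      ← ENNReal.ofReal_mul K.coe_nonneg]
    exact ENNReal.ofReal_le_ofReal (h y hy z hz)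
  have himage : f '' (g '' Ico 0 1) = Ico 0 1 := by
    rw [image_image]
    exact (image_congr hleft).trans (image_id' _)
  have hdim := hf.dimH_image_le hs
  rw [himage, Real.dimH_of_nonempty_interior (by simp)] at hdim
  simp only [Module.finrank_self, Nat.cast_one] at hdim
  rwa [ENNReal.le_div_iff_mul_le (by simp [hs.ne']) (by simp), one_mul] at hdim

open Classical in
/-- The partial quotients built from free digits `c`: on `C` each value exceeds the previous one
by `1`, off `C` the `n`-th value is `(n + 2) ^ (u + 1) + c n`. -/
noncomputable def runDigits (C : ℕ → Prop) (u : ℕ) (c : ℕ → ℕ) : ℕ → ℕ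
  | 0 => 2 ^ (u + 1) + c 0
  | n + 1 => if C (n + 1) then runDigits C u c n + 1 else (n + 3) ^ (u + 1) + c (n + 1)

open Classical in
/-- The number of admissible free digits at each index: `1` on `C` and `(n + 2) ^ u` off `C`. -/
noncomputable def runBase (C : ℕ → Prop) (u n : ℕ) : ℕ := if C n then 1 else (n + 2) ^ u

lemma runBase_pos (C : ℕ → Prop) (u n : ℕ) : 0 < runBase C u n := by
  rw [runBase]
  split_ifs <;> positivity

section RunDigits

variable {C : ℕ → Prop} {u : ℕ} {c d : ℕ → ℕ}

lemma runDigits_of_not {n : ℕ} (hn : ¬C n) :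
    runDigits C u c n = (n + 2) ^ (u + 1) + c n := by
  cases n with
  | zero => rfl
  | succ n => rw [runDigits, if_neg hn]

lemma runDigits_lt_of_not (hc : ∀ n, c n < runBase C u n) {n : ℕ} (hn : ¬C n) :
    runDigits C u c n < (n + 3) ^ (u + 1) := by
  have h := hc n
  rw [runBase, if_neg hn] at h
  rw [runDigits_of_not hn]
  calc _ < (n + 2) ^ (u + 1) + (n + 2) ^ u := by omega
    _ = (n + 2) ^ u * (n + 3) := by ring
    _ ≤ (n + 3) ^ u * (n + 3) := by gcongr; omega
    _ = _ := by ring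

lemma runDigits_lt (h0 : ¬C 0) (hc : ∀ n, c n < runBase C u n) (n : ℕ) :
    runDigits C u c n < (n + 3) ^ (u + 1) := by
  induction n with
  | zero => exact runDigits_lt_of_not hc h0
  | succ n ih =>
    by_cases hn : C (n + 1)
    · have h : (n + 3) ^ (u + 1) < (n + 1 + 3) ^ (u + 1) :=
        Nat.pow_lt_pow_left (by omega) (by omega)
      rw [runDigits, if_pos hn]
      omega
    · exact runDigits_lt_of_not hc hn

lemma runDigits_strictMono (h0 : ¬C 0) (hc : ∀ n, c n < runBase C u n) :
    StrictMono (runDigits C u c) := by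
  refine strictMono_nat_of_lt_succ fun n => ?_
  have h := runDigits_lt h0 hc n
  rw [runDigits]
  split_ifs <;> omega

lemma two_le_runDigits (h0 : ¬C 0) (hc : ∀ n, c n < runBase C u n) (n : ℕ) :
    2 ≤ runDigits C u c n := by
  have h1 := (runDigits_strictMono h0 hc).monotone (Nat.zero_le n)
  have h2 : 2 ^ 1 ≤ 2 ^ (u + 1) := Nat.pow_le_pow_right (by norm_num) (by omega)
  rw [runDigits] at h1
  omega

lemma runDigits_congr {n : ℕ} (h : ∀ k ≤ n, c k = d k) :
    runDigits C u c n = runDigits C u d n := by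
  induction n with
  | zero => rw [runDigits, runDigits, h 0 le_rfl]
  | succ n ih => rw [runDigits, runDigits, ih fun k hk => h k (by omega), h _ le_rfl]

lemma runDigits_ne (hc : ∀ n, c n < runBase C u n)
    (hd : ∀ n, d n < runBase C u n) {n : ℕ} (h : c n ≠ d n) :
    runDigits C u c n ≠ runDigits C u d n := by
  have hn : ¬C n := fun hn => by
    have h1 := hc n
    have h2 := hd n
    rw [runBase, if_pos hn] at h1 h2
    omega
  rw [runDigits_of_not hn, runDigits_of_not hn]
  omega

/-- The continued fraction with partial quotients `runDigits C u` of the mixed radix digits of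
`y`. -/
noncomputable def runPoint (C : ℕ → Prop) (u : ℕ) (y : ℝ) : ℝ :=
  cfValue (runDigits C u (radixDigit (runBase C u) y))

lemma radixDigit_lt_runBase {y : ℝ} (hy : y ∈ Ico (0 : ℝ) 1) (n : ℕ) :
    radixDigit (runBase C u) y n < runBase C u n :=
  radixDigit_lt hy (runBase_pos C u n)

lemma pq_runPoint (h0 : ¬C 0) {y : ℝ} (hy : y ∈ Ico (0 : ℝ) 1) (n : ℕ) :
    pq (runPoint C u y) (n + 1) = runDigits C u (radixDigit (runBase C u) y) n :=
  pq_cfValue n (two_le_runDigits h0 (radixDigit_lt_runBase hy))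

lemma runPoint_mem_Jset (h0 : ¬C 0) {y : ℝ} (hy : y ∈ Ico (0 : ℝ) 1) :
    runPoint C u y ∈ Jset := by
  have hc := two_le_runDigits h0 (radixDigit_lt_runBase (C := C) (u := u) hy)
  have h := (cfValue_mem_Icc hc).2
  refine ⟨⟨cfValue_pos hc, h.trans_lt (by norm_num)⟩, irrational_cfValue hc, fun n hn => ?_⟩
  obtain ⟨n, rfl⟩ := Nat.exists_eq_add_of_le' hn
  rw [pq_runPoint h0 hy, pq_runPoint h0 hy]
  exact runDigits_strictMono h0 (radixDigit_lt_runBase hy) n.lt_succ_self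

lemma exists_dist_le_and_le_dist_runPoint (h0 : ¬C 0) {y z : ℝ} (hy : y ∈ Ico (0 : ℝ) 1)
    (hz : z ∈ Ico (0 : ℝ) 1) (hyz : y ≠ z)
    (hlim : Tendsto (fun n => (∏ k ∈ Finset.range n, (runBase C u k : ℝ))⁻¹) atTop (𝓝 0)) :
    ∃ n, dist y z ≤ (∏ k ∈ Finset.range n, (runBase C u k : ℝ))⁻¹ ∧
      1 / 2 * (∏ k ∈ Finset.range (n + 1), (k + 3 : ℝ) ^ (u + 1))⁻¹ ^ 2 ≤
        dist (runPoint C u y) (runPoint C u z) := by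
  classical
  have hne := exists_radixDigit_ne (runBase_pos C u) hy hz hlim hyz
  have hcy := radixDigit_lt_runBase (C := C) (u := u) hy
  have hcz := radixDigit_lt_runBase (C := C) (u := u) hz
  have heq : ∀ k < Nat.find hne,
      radixDigit (runBase C u) y k = radixDigit (runBase C u) z k :=
    fun k hk => not_not.1 (Nat.find_min hne hk)
  have hM : ∀ {c : ℕ → ℕ}, (∀ n, c n < runBase C u n) →
      ∀ k, (runDigits C u c k + 1 : ℝ) ≤ (k + 3 : ℝ) ^ (u + 1) := fun hc k => by
    exact_mod_cast runDigits_lt h0 hc k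
  exact ⟨Nat.find hne, dist_le_of_radixDigit_eq (runBase_pos C u) hy hz _ heq,
    prod_sq_inv_le_dist_cfValue (two_le_runDigits h0 hcy) (two_le_runDigits h0 hcz)
      (hM hcy) (hM hcz) _
      (fun k hk => runDigits_congr fun j hj => heq j (by omega))
      (runDigits_ne hcy hcz (Nat.find_spec hne))⟩

end RunDigits

lemma eventually_log_le {s δ A : ℝ} {u : ℕ} (hu : 2 * s < u * δ) :
    ∀ᶠ n : ℕ in atTop, s * (Real.log 2 + 2 * (u + 1) * (n + 1) * Real.log (n + 3)) ≤
      u * (((2 * s + δ) * n - A) * (Real.log n + Real.log δ)) := by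
  have hn : Tendsto (fun n : ℕ => ((n : ℝ))⁻¹) atTop (𝓝 0) := tendsto_inv_atTop_nhds_zero_nat
  have hL : Tendsto (fun n : ℕ => (Real.log n)⁻¹) atTop (𝓝 0) :=
    (Real.tendsto_log_atTop.comp tendsto_natCast_atTop_atTop).inv_tendsto_atTop
  have hlog : Tendsto (fun n : ℕ => 1 + Real.log (1 + 3 * (n : ℝ)⁻¹) * (Real.log n)⁻¹) atTop
      (𝓝 (1 + Real.log (1 + 3 * 0) * 0)) :=
    (((hn.const_mul 3).const_add 1).log (by norm_num)).mul hL |>.const_add 1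
  have h1 : Tendsto (fun n : ℕ => s * (Real.log 2 * (n : ℝ)⁻¹ * (Real.log n)⁻¹ +
      2 * (u + 1) * (1 + (n : ℝ)⁻¹) * (1 + Real.log (1 + 3 * (n : ℝ)⁻¹) * (Real.log n)⁻¹)))
      atTop (𝓝 (s * (Real.log 2 * 0 * 0 +
        2 * (u + 1) * (1 + 0) * (1 + Real.log (1 + 3 * 0) * 0)))) :=
    ((((hn.const_mul _).mul hL).add (((hn.const_add 1).const_mul _).mul hlog))).const_mul s
  have h2 : Tendsto (fun n : ℕ => (u : ℝ) * ((2 * s + δ - A * (n : ℝ)⁻¹) *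
      (1 + Real.log δ * (Real.log n)⁻¹))) atTop
      (𝓝 (u * ((2 * s + δ - A * 0) * (1 + Real.log δ * 0)))) :=
    (((hn.const_mul A).const_sub _).mul ((hL.const_mul _).const_add 1)).const_mul _
  have hlt : s * (Real.log 2 * 0 * 0 + 2 * (u + 1) * (1 + 0) * (1 + Real.log (1 + 3 * 0) * 0)) <
      u * ((2 * s + δ - A * 0) * (1 + Real.log δ * 0)) := by
    ring_nf
    linarith
  filter_upwards [h1.eventually_lt h2 hlt, eventually_ge_atTop 2] with n h hn2
  have hn0 : (0 : ℝ) < n := by exact_mod_cast (by omega : 0 < n)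
  have hl0 : 0 < Real.log n := Real.log_pos (by exact_mod_cast (by omega : 1 < n))
  have hl3 : Real.log (n + 3) = Real.log n + Real.log (1 + 3 * (n : ℝ)⁻¹) := by
    rw [← Real.log_mul hn0.ne' (by positivity)]
    congr 1
    field_simp
  calc _ = n * Real.log n * (s * (Real.log 2 * (n : ℝ)⁻¹ * (Real.log n)⁻¹ +
      2 * (u + 1) * (1 + (n : ℝ)⁻¹) * (1 + Real.log (1 + 3 * (n : ℝ)⁻¹) * (Real.log n)⁻¹))) := by
        rw [hl3]
        field_simp
    _ ≤ n * Real.log n * (u * ((2 * s + δ - A * (n : ℝ)⁻¹) *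
      (1 + Real.log δ * (Real.log n)⁻¹))) := by gcongr
    _ = _ := by field_simp

open Classical in
lemma le_log_prod_runBase {C : ℕ → Prop} {γ A s δ : ℝ} (u : ℕ) (hγ : 0 < γ)
    (hδ : 0 < δ) (hγδ : γ⁻¹ ≤ 1 - 2 * s - 2 * δ) {n : ℕ}
    (hcard : γ * ((Finset.range n).filter C).card ≤ n + A) (hn : 1 ≤ δ * n) :
    u * (((2 * s + δ) * n - (A * γ⁻¹ + 1)) * (Real.log n + Real.log δ)) ≤
      Real.log (∏ k ∈ Finset.range n, (runBase C u k : ℝ)) := by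
  have hn0 : (0 : ℝ) < n := by
    by_contra! h
    nlinarith
  have hlog : 0 ≤ Real.log n + Real.log δ := by
    rw [add_comm, ← Real.log_mul hδ.ne' hn0.ne']
    exact Real.log_nonneg hn
  set F := (Finset.range n).filter (fun k => ¬C k ∧ ⌈δ * n⌉₊ ≤ k) with hF
  have hFcard : (2 * s + δ) * n - (A * γ⁻¹ + 1) ≤ F.card := by
    have hsub : Finset.range n ⊆ (F ∪ (Finset.range n).filter C) ∪ Finset.range ⌈δ * n⌉₊ := by
      intro k hk
      simp only [hF, Finset.mem_union, Finset.mem_filter, Finset.mem_range] at hk ⊢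
      have := lt_or_ge k ⌈δ * n⌉₊
      tauto
    have h1 : n ≤ F.card + ((Finset.range n).filter C).card + ⌈δ * n⌉₊ := by
      have h2 := Finset.card_le_card hsub
      have h3 := Finset.card_union_le (F ∪ (Finset.range n).filter C) (Finset.range ⌈δ * n⌉₊)
      have h4 := Finset.card_union_le F ((Finset.range n).filter C)
      simp only [Finset.card_range] at h2 h3
      omega
    have h1' : (n : ℝ) ≤ F.card + ((Finset.range n).filter C).card + ⌈δ * n⌉₊ := by
      exact_mod_cast h1
    have h2 := Nat.ceil_lt_add_one (by linarith : 0 ≤ δ * n)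
    have h3 : (((Finset.range n).filter C).card : ℝ) ≤ γ⁻¹ * (n + A) := by
      rw [inv_mul_eq_div, le_div_iff₀ hγ]
      linarith
    nlinarith
  have hnn : ∀ k, 0 ≤ Real.log (runBase C u k : ℝ) := fun k =>
    Real.log_natCast_nonneg _
  rw [Real.log_prod fun k _ => by exact_mod_cast (runBase_pos C u k).ne']
  calc _ ≤ u * (F.card * (Real.log n + Real.log δ)) := by gcongr
    _ = ∑ k ∈ F, u * (Real.log n + Real.log δ) := by
      rw [Finset.sum_const, nsmul_eq_mul]
      ring
    _ ≤ ∑ k ∈ F, Real.log (runBase C u k : ℝ) := by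
      refine Finset.sum_le_sum fun k hk => ?_
      obtain ⟨-, hCk, hk⟩ := Finset.mem_filter.1 hk
      have hk' := Nat.ceil_le.1 hk
      rw [runBase, if_neg hCk, Nat.cast_pow, Real.log_pow, add_comm (Real.log n),
        ← Real.log_mul hδ.ne' hn0.ne']
      push_cast
      gcongr
      linarith
    _ ≤ _ := Finset.sum_le_sum_of_subset_of_nonneg (Finset.filter_subset _ _) fun k _ _ => hnn k

lemma neg_le_log_prod_pow (u n : ℕ) :
    -(Real.log 2 + 2 * (u + 1) * (n + 1) * Real.log (n + 3)) ≤
      Real.log (1 / 2 * (∏ k ∈ Finset.range (n + 1), (k + 3 : ℝ) ^ (u + 1))⁻¹ ^ 2) := by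
  have hpos : 0 < ∏ k ∈ Finset.range (n + 1), (k + 3 : ℝ) ^ (u + 1) :=
    Finset.prod_pos fun k _ => by positivity
  have h : Real.log (∏ k ∈ Finset.range (n + 1), (k + 3 : ℝ) ^ (u + 1)) ≤
      (n + 1) * ((u + 1) * Real.log (n + 3)) := by
    rw [Real.log_prod fun k _ => by positivity]
    calc _ ≤ ∑ k ∈ Finset.range (n + 1), (u + 1) * Real.log (n + 3) := by
          refine Finset.sum_le_sum fun k hk => ?_
          have hk' : (k : ℝ) ≤ n := by
            exact_mod_cast Nat.lt_succ_iff.1 (Finset.mem_range.1 hk)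
          rw [Real.log_pow]
          push_cast
          gcongr
      _ = _ := by simp
  rw [Real.log_mul (by norm_num) (by positivity), Real.log_pow, Real.log_inv, one_div,
    Real.log_inv]
  push_cast
  linarith

open Classical in
lemma exists_prod_runBase_inv_le {C : ℕ → Prop} {γ A s δ : ℝ} {u : ℕ} (hγ : 0 < γ)
    (hs : 0 ≤ s) (hδ : 0 < δ) (hγδ : γ⁻¹ ≤ 1 - 2 * s - 2 * δ) (hu : 2 * s < u * δ)
    (hcard : ∀ n : ℕ, γ * ((Finset.range n).filter C).card ≤ n + A) :
    ∃ K : ℝ≥0, ∀ n, (∏ k ∈ Finset.range n, (runBase C u k : ℝ))⁻¹ ≤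
      K * (1 / 2 * (∏ k ∈ Finset.range (n + 1), (k + 3 : ℝ) ^ (u + 1))⁻¹ ^ 2) ^ s := by
  set Q : ℕ → ℝ := fun n => ∏ k ∈ Finset.range n, (runBase C u k : ℝ) with hQ
  set L : ℕ → ℝ := fun n =>
    1 / 2 * (∏ k ∈ Finset.range (n + 1), (k + 3 : ℝ) ^ (u + 1))⁻¹ ^ 2 with hL
  have hQpos : ∀ n, 0 < Q n := fun n =>
    Finset.prod_pos fun k _ => by exact_mod_cast runBase_pos C u k
  have hLpos : ∀ n, 0 < L n := fun n => by
    have : 0 < ∏ k ∈ Finset.range (n + 1), (k + 3 : ℝ) ^ (u + 1) :=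
      Finset.prod_pos fun k _ => by positivity
    positivity
  have hev : ∀ᶠ n in atTop, (Q n)⁻¹ / L n ^ s ≤ 1 := by
    filter_upwards [eventually_log_le (A := A * γ⁻¹ + 1) hu,
      (tendsto_natCast_atTop_atTop.const_mul_atTop hδ).eventually_ge_atTop 1] with n hn hn1
    have h1 := le_log_prod_runBase u hγ hδ hγδ (hcard n) hn1
    have h2 := mul_le_mul_of_nonneg_left (neg_le_log_prod_pow u n) hs
    rw [div_le_one (Real.rpow_pos_of_pos (hLpos n) s),
      ← Real.log_le_log_iff (inv_pos.2 (hQpos n)) (Real.rpow_pos_of_pos (hLpos n) s),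
      Real.log_inv, Real.log_rpow (hLpos n)]
    simp only [hQ, hL]
    linarith
  obtain ⟨K, hK⟩ := (Filter.isBoundedUnder_of_eventually_le hev).bddAbove_range
  refine ⟨K.toNNReal, fun n => ?_⟩
  rw [← div_le_iff₀ (Real.rpow_pos_of_pos (hLpos n) s)]
  exact (hK ⟨n, rfl⟩).trans (Real.le_coe_toNNReal K)

lemma tendsto_prod_pow_inv (u : ℕ) : Tendsto (fun n : ℕ =>
    1 / 2 * (∏ k ∈ Finset.range (n + 1), (k + 3 : ℝ) ^ (u + 1))⁻¹ ^ 2) atTop (𝓝 0) := by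
  have h : Tendsto (fun n : ℕ => ∏ k ∈ Finset.range (n + 1), (k + 3 : ℝ) ^ (u + 1))
      atTop atTop := by
    refine tendsto_atTop_mono (fun n => ?_)
      ((tendsto_pow_atTop_atTop_of_one_lt (by norm_num : (1 : ℝ) < 2)).comp
        (tendsto_add_atTop_nat 1))
    calc _ = ∏ k ∈ Finset.range (n + 1), (2 : ℝ) := by simp
      _ ≤ _ := by
        refine Finset.prod_le_prod (fun _ _ => by norm_num) fun k _ => ?_
        have hk : (2 : ℝ) ≤ k + 3 := by linarith [(k.cast_nonneg : (0 : ℝ) ≤ k)]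
        exact hk.trans (le_self_pow₀ (by linarith) (by omega))
  simpa using (h.inv_tendsto_atTop.pow 2).const_mul (1 / 2 : ℝ)

open Classical in
/-- If `C` has few elements, the points `runPoint C u y` form a set of large dimension. -/
lemma le_dimH_image_runPoint {C : ℕ → Prop} {γ A δ : ℝ} {s : ℝ≥0} {u : ℕ} (h0 : ¬C 0)
    (hγ : 0 < γ) (hs : 0 < s) (hδ : 0 < δ) (hγδ : γ⁻¹ ≤ 1 - 2 * s - 2 * δ)
    (hu : 2 * s < u * δ)
    (hcard : ∀ n : ℕ, γ * ((Finset.range n).filter C).card ≤ n + A) :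
    (s : ℝ≥0∞) ≤ dimH (runPoint C u '' Ico 0 1) := by
  obtain ⟨K, hK⟩ := exists_prod_runBase_inv_le hγ s.coe_nonneg hδ hγδ hu hcard
  have hs' : (0 : ℝ) < s := hs
  have hlim : Tendsto (fun n => (∏ k ∈ Finset.range n, (runBase C u k : ℝ))⁻¹) atTop (𝓝 0) := by
    refine squeeze_zero (fun n => by positivity) hK ?_
    have h := ((tendsto_prod_pow_inv u).rpow_const (p := (s : ℝ)) (.inr hs'.le)).const_mul (K : ℝ)
    rwa [Real.zero_rpow hs'.ne', mul_zero] at h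
  refine le_dimH_image_of_dist_le (K := K) hs fun y hy z hz => ?_
  rcases eq_or_ne y z with rfl | hyz
  · rw [dist_self]
    positivity
  · obtain ⟨n, h1, h2⟩ := exists_dist_le_and_le_dist_runPoint h0 hy hz hyz hlim
    refine h1.trans ((hK n).trans ?_)
    gcongr

section Gaps

variable {σ : ℕ → ℕ} {γ : ℝ}

lemma exists_mul_le_of_eventually_mul_le (hmono : ∀ n : ℕ, 1 ≤ n → σ n < σ (n + 1))
    (hγ : 0 ≤ γ) (h : ∀ᶠ n : ℕ in atTop, γ * n ≤ ((σ (n + 1) - σ n : ℕ) : ℝ)) :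
    ∃ A : ℝ, 0 ≤ A ∧ ∀ m : ℕ, γ * (m * (m + 1) / 2) ≤ σ (m + 1) + A := by
  obtain ⟨N, hN⟩ := eventually_atTop.1 h
  refine ⟨γ * (N * (N + 1) / 2), by positivity, fun m => ?_⟩
  rcases le_total m N with hm | hm
  · have : γ * (m * (m + 1) / 2 : ℝ) ≤ γ * (N * (N + 1) / 2) := by gcongr
    have h0 : (0 : ℝ) ≤ σ (m + 1) := Nat.cast_nonneg _
    linarith
  · induction m, hm using Nat.le_induction with
    | base => simp
    | succ m hm ih =>
      have h1 := hN (m + 1) (by omega)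
      rw [Nat.cast_sub (hmono (m + 1) (by omega)).le] at h1
      push_cast at h1 ⊢
      linarith

open Classical in
lemma exists_mul_card_le (hmono : ∀ n : ℕ, 1 ≤ n → σ n < σ (n + 1))
    (hγ : 0 ≤ γ) (h : ∀ᶠ n : ℕ in atTop, γ * n ≤ ((σ (n + 1) - σ n : ℕ) : ℝ)) :
    ∃ A : ℝ, ∀ n : ℕ, γ * ((Finset.range n).filter
      (fun k => ∃ j, 1 ≤ j ∧ σ j < k + 1 ∧ k + 1 < σ j + j)).card ≤ n + A := by
  obtain ⟨A, hA0, hA⟩ := exists_mul_le_of_eventually_mul_le hmono hγ h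
  refine ⟨A, fun n => ?_⟩
  have hτ : StrictMono fun m => σ (m + 1) :=
    strictMono_nat_of_lt_succ fun m => hmono (m + 1) (by omega)
  have hex : ∃ m, n < σ (m + 1) := ⟨n + 1, (Nat.lt_succ_self n).trans_le (hτ.id_le (n + 1))⟩
  set m := Nat.find hex
  have hsub : (Finset.range n).filter
      (fun k => ∃ j, 1 ≤ j ∧ σ j < k + 1 ∧ k + 1 < σ j + j) ⊆
      (Finset.range m).biUnion fun i => Finset.Ico (σ (i + 1)) (σ (i + 1) + i) := by
    intro k hk
    simp only [Finset.mem_filter, Finset.mem_range, Finset.mem_biUnion, Finset.mem_Ico] at hk ⊢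
    obtain ⟨hkn, j, hj, h1, h2⟩ := hk
    obtain ⟨i, rfl⟩ := Nat.exists_eq_add_of_le' hj
    have hlt : σ (i + 1) < σ (m + 1) := by
      have : n < σ (m + 1) := Nat.find_spec hex
      omega
    exact ⟨i, hτ.lt_iff_lt.1 hlt, by omega, by omega⟩
  have hcard := (Finset.card_le_card hsub).trans Finset.card_biUnion_le
  simp only [Nat.card_Ico, add_tsub_cancel_left] at hcard
  rcases Nat.eq_zero_or_pos m with hm | hm
  · rw [hm, Finset.range_zero, Finset.sum_empty, Nat.le_zero] at hcard
    rw [hcard]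
    push_cast
    nlinarith [(n.cast_nonneg : (0 : ℝ) ≤ n)]
  · obtain ⟨l, hl⟩ := Nat.exists_eq_add_of_le' hm
    have hle : σ (l + 1) ≤ n := not_lt.1 (Nat.find_min hex (show l < m by omega))
    have h2 := Finset.sum_range_id_mul_two m
    rw [hl, Nat.add_sub_cancel] at h2
    rw [hl] at hcard
    have h3 : ((∑ i ∈ Finset.range (l + 1), i : ℕ) : ℝ) = l * (l + 1) / 2 := by
      rw [eq_div_iff two_ne_zero]
      exact_mod_cast h2.trans (mul_comm _ _)
    have h4 : (σ (l + 1) : ℝ) ≤ n := by exact_mod_cast hle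
    calc _ ≤ γ * ((∑ i ∈ Finset.range (l + 1), i : ℕ) : ℝ) := by gcongr
      _ ≤ n + A := by
        rw [h3]
        linarith [hA l]

end Gaps

lemma runPoint_mem_Gset {σ : ℕ → ℕ} (hσ : ∀ n, 1 ≤ n → 1 ≤ σ n) (u : ℕ) {y : ℝ}
    (hy : y ∈ Ico (0 : ℝ) 1) :
    runPoint (fun k => ∃ j, 1 ≤ j ∧ σ j < k + 1 ∧ k + 1 < σ j + j) u y ∈ Gset σ := by
  have h0 : ¬∃ j, 1 ≤ j ∧ σ j < 0 + 1 ∧ 0 + 1 < σ j + j := by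
    rintro ⟨j, hj, h1, -⟩
    have := hσ j hj
    omega
  refine ⟨runPoint_mem_Jset h0 hy, 1, fun n hn => ⟨1, fun i hi => ?_⟩⟩
  obtain ⟨m, hm⟩ := Nat.exists_eq_add_of_le' (hσ n hn)
  rw [show σ n + i + 1 = m + i + 1 + 1 by omega, show σ n + i = m + i + 1 by omega,
    pq_runPoint h0 hy, pq_runPoint h0 hy, runDigits, if_pos ⟨n, hn, by omega, by omega⟩]
  push_cast
  ring

/-- Proposition 4.2 (lower bound, case `β < ∞`): `dim_H G((σ_n)) ≥ (β-1)/(2β)` where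
`β = lim (σ_{n+1} - σ_n)/n < ∞`. -/
theorem stmt7 (σ : ℕ → ℕ) (hσ1 : 1 ≤ σ 1)
    (hmono : ∀ n : ℕ, 1 ≤ n → σ n < σ (n + 1))
    (hgap : ∀ n : ℕ, 1 ≤ n → n ≤ σ (n + 1) - σ n)
    (β : ℝ) (hβ : 1 ≤ β)
    (hlim : Filter.Tendsto (fun n : ℕ => ((σ (n + 1) - σ n : ℕ) : ℝ) / (n : ℝ))
      Filter.atTop (nhds β)) :
    ENNReal.ofReal ((β - 1) / (2 * β)) ≤ dimH (Gset σ) := by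
  refine ENNReal.le_of_forall_nnreal_lt fun s hs => ?_
  rcases eq_zero_or_pos s with rfl | hs0
  · simp
  have hβ0 : 0 < β := by linarith
  have hs1 : 2 * (s : ℝ) < 1 - β⁻¹ := by
    rw [← ENNReal.ofReal_coe_nnreal] at hs
    have h := (ENNReal.ofReal_lt_ofReal_iff_of_nonneg s.coe_nonneg).1 hs
    rw [lt_div_iff₀ (by positivity)] at h
    rw [lt_sub_iff_add_lt, ← lt_sub_iff_add_lt', inv_lt_iff_one_lt_mul₀ hβ0]
    linarith
  set δ : ℝ := (1 - β⁻¹ - 2 * s) / 3 with hδdef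
  have hδ : 0 < δ := by
    rw [hδdef]
    linarith
  have hβinv := inv_pos.2 hβ0
  set γ : ℝ := (β⁻¹ + δ)⁻¹ with hγdef
  have hγ : 0 < γ := by positivity
  have hγβ : γ < β := by
    rw [hγdef, inv_lt_comm₀ (by positivity) hβ0]
    linarith
  have hγδ : γ⁻¹ ≤ 1 - 2 * s - 2 * δ := by
    rw [hγdef, inv_inv, hδdef]
    linarith
  obtain ⟨u, hu⟩ := exists_nat_gt (2 * (s : ℝ) / δ)
  rw [div_lt_iff₀ hδ] at hu
  have hev : ∀ᶠ n : ℕ in atTop, γ * n ≤ ((σ (n + 1) - σ n : ℕ) : ℝ) := by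
    filter_upwards [hlim.eventually_const_lt hγβ, eventually_gt_atTop 0] with n h hn
    have hn' : (0 : ℝ) < n := by exact_mod_cast hn
    exact ((lt_div_iff₀ hn').1 h).le
  obtain ⟨A, hA⟩ := exists_mul_card_le hmono hγ.le hev
  have hσ : ∀ n, 1 ≤ n → 1 ≤ σ n := fun n hn => by
    induction n, hn using Nat.le_induction with
    | base => exact hσ1
    | succ n hn ih => exact ih.trans (hmono n hn).le
  have h0 : ¬∃ j, 1 ≤ j ∧ σ j < 0 + 1 ∧ 0 + 1 < σ j + j := by
    rintro ⟨j, hj, h1, -⟩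
    have := hσ j hj
    omega
  refine (le_dimH_image_runPoint h0 hγ hs0 hδ hγδ hu hA).trans (dimH_mono ?_)
  rintro _ ⟨y, hy, rfl⟩
  exact runPoint_mem_Gset hσ u hy
end
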